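/- arXiv:2409.09664 — 8 statements merged into one kernel-verified Lean document; each statement's English description precedes it below -/
import Mathlib

section
/- Let g ∈ 𝓡(k) and f_s ∈ 𝓡(j_s) for s = 1,…,k, and set J := j_1 + ⋯ + j_k. Define F_s ∈ ℤ[a_1,…,a_J] by renaming the variables of f_s along i ↦ j_1 + ⋯ + j_{s−1} + i. Then the composite polynomial g(F_1, F_2, …, F_k), obtained by substituting F_s for the s-th variable of g, lies in 𝓡(J). In other words, the collection ⨿_n 𝓡(n) is closed under composition of polynomials. -/
open MvPolynomial

/-- `f ∈ 𝓡(n)`: `f` is a sum of distinct monic squarefree monomials of positive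
degree: all coefficients of monomials in the support are `1`, all exponents are
`≤ 1`, and the constant coefficient vanishes. -/
def IsRPoly {n : ℕ} (f : MvPolynomial (Fin n) ℤ) : Prop :=
  (∀ d ∈ f.support, f.coeff d = 1) ∧
  (∀ d ∈ f.support, ∀ i, d i ≤ 1) ∧
  f.coeff 0 = 0

/-- The index `j₁ + ⋯ + j_{s-1} + i` in `Fin (j₁ + ⋯ + j_k)` corresponding to the
`i`-th variable of the `s`-th block. -/
def blockIdx {k : ℕ} (j : Fin k → ℕ) (s : Fin k) (i : Fin (j s)) : Fin (∑ t, j t) :=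
  ⟨(∑ t ∈ Finset.univ.filter (fun t => t < s), j t) + i.1, by
    have h1 : (∑ t ∈ Finset.univ.filter (fun t => t < s), j t) + j s ≤ ∑ t, j t := by
      have h2 : (insert s (Finset.univ.filter (fun t => t < s))).sum j ≤
          ∑ t : Fin k, j t :=
        Finset.sum_le_sum_of_subset (fun x _ => Finset.mem_univ x)
      rw [Finset.sum_insert (by simp)] at h2
      omega
    have h3 := i.2
    omega⟩

theorem blockIdx_lt_of_lt {k : ℕ} (j : Fin k → ℕ) {s t : Fin k} (hst : s < t)
    (i : Fin (j s)) (i' : Fin (j t)) : blockIdx j s i < blockIdx j t i' := by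
  have h : (insert s (Finset.univ.filter (fun u => u < s))).sum j ≤
      ∑ u ∈ Finset.univ.filter (fun u => u < t), j u := by
    refine Finset.sum_le_sum_of_subset fun x hx => ?_
    simp only [Finset.mem_insert, Finset.mem_filter, Finset.mem_univ, true_and] at hx ⊢
    rcases hx with rfl | hx
    exacts [hst, hx.trans hst]
  rw [Finset.sum_insert (by simp)] at h
  simp only [blockIdx, Fin.mk_lt_mk]
  omega

theorem blockIdx_injective {k : ℕ} (j : Fin k → ℕ) (s : Fin k) :
    Function.Injective (blockIdx j s) := by
  intro i i' h
  simpa [blockIdx, Fin.ext_iff] using h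

theorem blockIdx_sigma_bijective {k : ℕ} (j : Fin k → ℕ) :
    Function.Bijective (fun p : Σ s, Fin (j s) => blockIdx j p.1 p.2) := by
  rw [Fintype.bijective_iff_injective_and_card]
  refine ⟨?_, by simp⟩
  rintro ⟨s, i⟩ ⟨t, i'⟩ h
  rcases lt_trichotomy s t with hst | rfl | hst
  · exact absurd h (blockIdx_lt_of_lt j hst i i').ne
  · exact congrArg (Sigma.mk s) (blockIdx_injective j s h)
  · exact absurd h (blockIdx_lt_of_lt j hst i' i).ne'

theorem exists_block {k : ℕ} (j : Fin k → ℕ) :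
    ∃ b : Fin (∑ t, j t) → Fin k, ∀ s i, b (blockIdx j s i) = s := by
  let e := Equiv.ofBijective _ (blockIdx_sigma_bijective j)
  exact ⟨fun x => (e.symm x).1, fun s i =>
    congrArg Sigma.fst (e.symm_apply_apply ⟨s, i⟩)⟩

/-- The coefficients of a product of polynomials in disjoint blocks of variables, where the block
of a variable is given by `b`. -/
theorem coeff_prod_of_blocks {σ ι R : Type*} [Fintype ι] [DecidableEq ι] [CommSemiring R]
    (b : σ → ι) (G : ι → MvPolynomial σ R)
    (hG : ∀ s, ∀ d ∈ (G s).support, ∀ i, d i ≠ 0 → b i = s) (m : σ →₀ ℕ) :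
    (∏ s, G s).coeff m = ∏ s, (G s).coeff (m.filter (fun i => b i = s)) := by
  classical
  have key : ∀ p ∈ Fintype.piFinset (fun s => (G s).support), ∑ s, p s = m →
      p = fun s => m.filter (fun i => b i = s) := by
    rintro p hp rfl
    rw [Fintype.mem_piFinset] at hp
    funext s
    ext i
    by_cases hi : b i = s
    · rw [Finsupp.filter_apply_pos (fun i => b i = s) _ hi, Finsupp.finsetSum_apply, Finset.sum_eq_single s]
      · intro t _ hts
        by_contra h
        exact hts ((hG t _ (hp t) i h).symm.trans hi)
      · simp
    · rw [Finsupp.filter_apply_neg (fun i => b i = s) _ hi]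
      by_contra h
      exact hi (hG s _ (hp s) i h)
  have hsum : ∑ s, m.filter (fun i => b i = s) = m := by
    ext i
    simp [Finsupp.finsetSum_apply, Finsupp.filter_apply]
  have hexp : ∏ s, G s = ∑ p ∈ Fintype.piFinset (fun s => (G s).support),
      monomial (∑ s, p s) (∏ s, (G s).coeff (p s)) := by
    conv_lhs => enter [2, s]; rw [(G s).as_sum]
    rw [Finset.prod_univ_sum]
    exact Finset.sum_congr rfl fun p _ => (monomial_sum_prod _ _ _).symm
  rw [hexp, coeff_sum, Finset.sum_eq_single (fun s => m.filter (fun i => b i = s))]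
  · rw [hsum, coeff_monomial, if_pos rfl]
  · intro p hp hne
    rw [coeff_monomial, if_neg fun h => hne (key p hp h)]
  · intro h
    simp only [Fintype.mem_piFinset, not_forall, notMem_support_iff] at h
    obtain ⟨s, hs⟩ := h
    rw [Finset.prod_eq_zero (Finset.mem_univ s) hs, monomial_zero, coeff_zero]

theorem support_rename_blockIdx {k : ℕ} {j : Fin k → ℕ} {b : Fin (∑ t, j t) → Fin k}
    (hb : ∀ s i, b (blockIdx j s i) = s) (s : Fin k) (f : MvPolynomial (Fin (j s)) ℤ) :
    ∀ d ∈ (rename (blockIdx j s) f).support, ∀ i, d i ≠ 0 → b i = s := by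
  classical
  intro d hd i hi
  rw [support_rename_of_injective (blockIdx_injective j s), Finset.mem_image] at hd
  obtain ⟨e, -, rfl⟩ := hd
  by_contra h
  refine hi (Finsupp.mapDomain_of_notMem_range _ _ ?_)
  rintro ⟨i', rfl⟩
  exact h (hb s i')

theorem IsRPoly.rename {n n' : ℕ} {f : MvPolynomial (Fin n) ℤ} (hf : IsRPoly f)
    {r : Fin n → Fin n'} (hr : Function.Injective r) : IsRPoly (MvPolynomial.rename r f) := by
  classical
  refine ⟨fun d hd => ?_, fun d hd i => ?_, ?_⟩
  · rw [support_rename_of_injective hr, Finset.mem_image] at hd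
    obtain ⟨e, he, rfl⟩ := hd
    rw [coeff_rename_mapDomain _ hr]
    exact hf.1 e he
  · rw [support_rename_of_injective hr, Finset.mem_image] at hd
    obtain ⟨e, he, rfl⟩ := hd
    by_cases h : i ∈ Set.range r
    · obtain ⟨i', rfl⟩ := h
      rw [Finsupp.mapDomain_apply hr]
      exact hf.2.1 e he i'
    · rw [Finsupp.mapDomain_of_notMem_range _ _ h]
      exact zero_le_one
  · have h := coeff_rename_mapDomain r hr f 0
    rwa [Finsupp.mapDomain_zero, hf.2.2] at h

/-- Substituting elements of `𝓡(n)` in pairwise disjoint blocks of variables into an element of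
`𝓡(k)` gives an element of `𝓡(n)`. -/
theorem IsRPoly.bind₁_of_blocks {k n : ℕ} {g : MvPolynomial (Fin k) ℤ} (hg : IsRPoly g)
    (b : Fin n → Fin k) {F : Fin k → MvPolynomial (Fin n) ℤ} (hF : ∀ s, IsRPoly (F s))
    (hFb : ∀ s, ∀ d ∈ (F s).support, ∀ i, d i ≠ 0 → b i = s) : IsRPoly (bind₁ F g) := by
  classical
  let part (m : Fin n →₀ ℕ) (s : Fin k) : Fin n →₀ ℕ := m.filter (fun i => b i = s)
  have hexp : ∀ m, (bind₁ F g).coeff m =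
      ∑ d ∈ g.support, ∏ s, (F s ^ d s).coeff (part m s) := by
    intro m
    rw [bind₁, aeval_def, eval₂_eq', coeff_sum]
    refine Finset.sum_congr rfl fun d hd => ?_
    rw [hg.1 d hd, map_one, one_mul]
    refine coeff_prod_of_blocks b _ (fun s e he i hi => ?_) m
    have hds := hg.2.1 d hd s
    interval_cases hs : d s
    · rw [pow_zero, mem_support_iff, coeff_one] at he
      have : e = 0 := by by_contra h; exact he (if_neg (Ne.symm h))
      simp [this] at hi
    · rw [pow_one] at he
      exact hFb s e he i hi
  -- The only `d` that can contribute to the coefficient of `m` is the indicator of the blocks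
  -- which `m` meets.
  have factor : ∀ d ∈ g.support, ∀ m s, (F s ^ d s).coeff (part m s) ≠ 0 →
      (F s ^ d s).coeff (part m s) = 1 ∧ (∀ i, part m s i ≤ 1) ∧
        d s = if part m s = 0 then 0 else 1 := by
    intro d hd m s h
    have hds := hg.2.1 d hd s
    interval_cases hs : d s
    · rw [pow_zero, coeff_one] at h ⊢
      have h0 : part m s = 0 := by by_contra h'; exact h (if_neg (Ne.symm h'))
      simp [h0]
    · rw [pow_one] at h ⊢
      have h0 : part m s ≠ 0 := fun h' => h (by rw [h', (hF s).2.2])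
      have hmem := mem_support_iff.2 h
      exact ⟨(hF s).1 _ hmem, (hF s).2.1 _ hmem, by rw [if_neg h0]⟩
  have unique : ∀ m, ∀ d ∈ g.support, ∏ s, (F s ^ d s).coeff (part m s) ≠ 0 →
      ∀ s, d s = if part m s = 0 then 0 else 1 := fun m d hd h s =>
    (factor d hd m s (Finset.prod_ne_zero_iff.1 h s (Finset.mem_univ s))).2.2
  have main : ∀ m ∈ (bind₁ F g).support, ∃ d ∈ g.support,
      (bind₁ F g).coeff m = ∏ s, (F s ^ d s).coeff (part m s) := by
    intro m hm
    rw [mem_support_iff, hexp] at hm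
    obtain ⟨d, hd, hne⟩ := Finset.exists_ne_zero_of_sum_ne_zero hm
    refine ⟨d, hd, ?_⟩
    rw [hexp, Finset.sum_eq_single_of_mem d hd]
    intro d' hd' hdd
    by_contra h
    exact hdd (Finsupp.ext fun s => (unique m d' hd' h s).trans (unique m d hd hne s).symm)
  refine ⟨fun m hm => ?_, fun m hm i => ?_, ?_⟩
  · obtain ⟨d, hd, h⟩ := main m hm
    have hne := mem_support_iff.1 hm
    rw [h] at hne ⊢
    exact Finset.prod_eq_one fun s hs =>
      (factor d hd m s (Finset.prod_ne_zero_iff.1 hne s hs)).1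
  · obtain ⟨d, hd, h⟩ := main m hm
    have hne := mem_support_iff.1 hm
    rw [h] at hne
    have := (factor d hd m (b i) (Finset.prod_ne_zero_iff.1 hne _ (Finset.mem_univ _))).2.1 i
    rwa [Finsupp.filter_apply_pos (fun i' => b i' = b i) m rfl] at this
  · rw [hexp]
    refine Finset.sum_eq_zero fun d hd => ?_
    by_contra h
    have hd0 : d = 0 := Finsupp.ext fun s =>
      (unique 0 d hd h s).trans (if_pos (Finsupp.filter_zero _))
    exact mem_support_iff.1 hd (hd0 ▸ hg.2.2)

/-- 𝓡 is closed under composition of polynomials: substituting the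
(variable-renamed) `f s ∈ 𝓡(j s)` into `g ∈ 𝓡(k)` yields an element of
`𝓡(j₁ + ⋯ + j_k)`. -/
theorem rpoly_comp (k : ℕ) (j : Fin k → ℕ) (g : MvPolynomial (Fin k) ℤ)
    (f : ∀ s : Fin k, MvPolynomial (Fin (j s)) ℤ)
    (hg : IsRPoly g) (hf : ∀ s, IsRPoly (f s)) :
    IsRPoly (MvPolynomial.bind₁
      (fun s : Fin k => MvPolynomial.rename (blockIdx j s) (f s)) g) := by
  obtain ⟨b, hb⟩ := exists_block j
  exact hg.bind₁_of_blocks b (fun s => (hf s).rename (blockIdx_injective j s))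
    fun s => support_rename_blockIdx hb s (f s)
end

section
/- Every doubly based map φ : 𝐦_e → 𝐧_e admits a decomposition φ = p ∘ σ with σ : 𝐦_e → 𝐤_e singular and p : 𝐤_e → 𝐧_e effective, and this decomposition is unique (in particular k, σ, and p are uniquely determined by φ). -/
/-- The doubly based set `𝐦_e = {0, e, 1, …, m}`: `Sum.inl i` is the element
`i+1 ∈ {1,…,m}`, `Sum.inr false` is `0` and `Sum.inr true` is `e`. -/
def BSet (m : ℕ) := Fin m ⊕ Bool

/-- A doubly based map sends `0 ↦ 0` and `e ↦ e`. -/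
def IsBased {m n : ℕ} (φ : BSet m → BSet n) : Prop :=
  ∀ b : Bool, φ (Sum.inr b) = Sum.inr b

/-- `φ` is effective if `φ⁻¹(0) = {0}` and `φ⁻¹(e) = {e}`, i.e. no element of
`{1,…,m}` is mapped to a basepoint. -/
def Effective {m n : ℕ} (φ : BSet m → BSet n) : Prop :=
  ∀ i : Fin m, ∃ j : Fin n, φ (Sum.inl i) = Sum.inl j

/-- `φ` is singular if it is surjective and is order preserving on the elements
of `{1,…,m}` not sent to a basepoint. -/
def Singular {m n : ℕ} (φ : BSet m → BSet n) : Prop :=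
  Function.Surjective φ ∧
  ∀ i j : Fin m, i < j → ∀ pi pj : Fin n,
    φ (Sum.inl i) = Sum.inl pi → φ (Sum.inl j) = Sum.inl pj → pi < pj

namespace BSet

variable {m n k : ℕ}

/-- The indices in `{1,…,m}` which `φ` does not send to a basepoint. -/
def support (φ : BSet m → BSet n) : Set (Fin m) :=
  {i | ∃ j, φ (Sum.inl i) = Sum.inl j}

theorem apply_eq_inl_iff {σ : BSet m → BSet k} {p : BSet k → BSet n} (hp : IsBased p)
    (hpe : Effective p) (i : Fin m) :
    (∃ j, (p ∘ σ) (Sum.inl i) = Sum.inl j) ↔ ∃ j, σ (Sum.inl i) = Sum.inl j := by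
  change (∃ j, p (σ (Sum.inl i)) = Sum.inl j) ↔ _
  rcases h : σ (Sum.inl i) with j | b
  · exact iff_of_true (hpe j) ⟨j, rfl⟩
  · refine iff_of_false ?_ ?_
    · rintro ⟨j, hj⟩
      cases (hp b).symm.trans hj
    · rintro ⟨j, hj⟩
      cases hj

/-- A based singular map has a strictly monotone section on the non-base elements, whose range is
the support. -/
theorem exists_strictMono_section {σ : BSet m → BSet k} (hσ : IsBased σ) (hs : Singular σ) :
    ∃ g : Fin k → Fin m, StrictMono g ∧ Set.range g = support σ ∧
      ∀ j, σ (Sum.inl (g j)) = Sum.inl j := by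
  have hex (j : Fin k) : ∃ i : Fin m, σ (Sum.inl i) = Sum.inl j := by
    obtain ⟨i | b, h⟩ := hs.1 (Sum.inl j)
    · exact ⟨i, h⟩
    · cases (hσ b).symm.trans h
  choose g hg using hex
  refine ⟨g, fun a b hab => ?_, Set.ext fun i => ⟨?_, ?_⟩, hg⟩
  · by_contra! hle
    rcases hle.lt_or_eq with hlt | heq
    · exact lt_asymm hab (hs.2 _ _ hlt _ _ (hg b) (hg a))
    · have h := hg a
      rw [← heq, hg b] at h
      exact hab.ne' (Sum.inl_injective h)
  · rintro ⟨j, rfl⟩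
    exact ⟨j, hg j⟩
  · rintro ⟨j, hj⟩
    refine ⟨j, ?_⟩
    rcases lt_trichotomy (g j) i with h | h | h
    · exact (lt_irrefl _ (hs.2 _ _ h _ _ (hg j) hj)).elim
    · exact h
    · exact (lt_irrefl _ (hs.2 _ _ h _ _ hj (hg j))).elim

theorem factorization_unique {k' : ℕ} {σ : BSet m → BSet k} {p : BSet k → BSet n}
    {σ' : BSet m → BSet k'} {p' : BSet k' → BSet n}
    (hσ : IsBased σ) (hp : IsBased p) (hs : Singular σ) (hpe : Effective p)
    (hσ' : IsBased σ') (hp' : IsBased p') (hs' : Singular σ') (hpe' : Effective p')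
    (h : p ∘ σ = p' ∘ σ') : k' = k ∧ HEq σ' σ ∧ HEq p' p := by
  obtain ⟨g, hg, hgr, hgσ⟩ := exists_strictMono_section hσ hs
  obtain ⟨g', hg', hgr', hgσ'⟩ := exists_strictMono_section hσ' hs'
  have hsupp : support σ' = support σ := by
    ext i
    exact (apply_eq_inl_iff hp' hpe' i).symm.trans (h ▸ apply_eq_inl_iff hp hpe i)
  have hr : Set.range g' = Set.range g := by rw [hgr, hgr', hsupp]
  obtain rfl : k' = k := by
    have hc := congrArg Set.ncard hr
    rwa [← Set.image_univ, ← Set.image_univ, Set.ncard_image_of_injective _ hg'.injective,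
      Set.ncard_image_of_injective _ hg.injective, Set.ncard_univ, Set.ncard_univ,
      Nat.card_fin, Nat.card_fin] at hc
  obtain rfl : g' = g := (hg'.range_inj hg).1 hr
  obtain rfl : σ' = σ := by
    funext x
    rcases x with i | b
    · by_cases hi : i ∈ support σ
      · rw [← hgr] at hi
        obtain ⟨j, rfl⟩ := hi
        rw [hgσ, hgσ']
      · have hi' := hi
        rw [← hsupp] at hi'
        have hpi : p (σ (Sum.inl i)) = p' (σ' (Sum.inl i)) := congrFun h (Sum.inl i)
        rcases h1 : σ (Sum.inl i) with j | b
        · exact (hi ⟨j, h1⟩).elim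
        rcases h2 : σ' (Sum.inl i) with j | b'
        · exact (hi' ⟨j, h2⟩).elim
        rw [h1, h2] at hpi
        exact congrArg Sum.inr
          (Sum.inr_injective ((hp' b').symm.trans (hpi.symm.trans (hp b))))
    · rw [hσ b, hσ' b]
  exact ⟨rfl, HEq.rfl, heq_of_eq (hs.1.injective_comp_right h.symm)⟩

theorem exists_factorization {φ : BSet m → BSet n} (hφ : IsBased φ) :
    ∃ (k : ℕ) (σ : BSet m → BSet k) (p : BSet k → BSet n),
      IsBased σ ∧ IsBased p ∧ Singular σ ∧ Effective p ∧ φ = p ∘ σ := by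
  classical
  let S : Finset (Fin m) := (support φ).toFinset
  have hS (i : Fin m) : i ∈ S ↔ ∃ j, φ (Sum.inl i) = Sum.inl j :=
    Set.mem_toFinset
  let e : Fin S.card ≃o S := S.orderIsoOfFin rfl
  let σ : BSet m → BSet S.card := Sum.elim
    (fun i => if h : i ∈ S then Sum.inl (e.symm ⟨i, h⟩)
      else Sum.elim (fun _ => Sum.inr false) Sum.inr (φ (Sum.inl i))) Sum.inr
  let p : BSet S.card → BSet n := Sum.elim (fun j => φ (Sum.inl (e j : Fin m))) Sum.inr
  have hσmem (i : Fin m) (h : i ∈ S) : σ (Sum.inl i) = Sum.inl (e.symm ⟨i, h⟩) := dif_pos h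
  have hσnot (i : Fin m) (h : i ∉ S) (b : Bool) (hb : φ (Sum.inl i) = Sum.inr b) :
      σ (Sum.inl i) = Sum.inr b := by
    refine (dif_neg h).trans ?_
    rw [hb]
    rfl
  have hnot (i : Fin m) (h : i ∉ S) : ∃ b, φ (Sum.inl i) = Sum.inr b := by
    rcases hi : φ (Sum.inl i) with j | b
    · exact (h ((hS i).2 ⟨j, hi⟩)).elim
    · exact ⟨b, rfl⟩
  have hσinl (i : Fin m) (a : Fin S.card) (h : σ (Sum.inl i) = Sum.inl a) :
      (e a : Fin m) = i := by
    by_cases hi : i ∈ S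
    · have ha := Sum.inl_injective ((hσmem i hi).symm.trans h)
      rw [← ha, e.apply_symm_apply]
    · obtain ⟨b, hb⟩ := hnot i hi
      cases (hσnot i hi b hb).symm.trans h
  refine ⟨S.card, σ, p, fun _ => rfl, fun _ => rfl, ⟨?_, ?_⟩, fun j => (hS _).1 (e j).2, ?_⟩
  · rintro (j | b)
    · refine ⟨Sum.inl (e j : Fin m), (hσmem _ (e j).2).trans ?_⟩
      exact congrArg Sum.inl (e.symm_apply_apply j)
    · exact ⟨Sum.inr b, rfl⟩
  · intro i j hij a b ha hb
    rw [← hσinl i a ha, ← hσinl j b hb] at hij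
    exact e.lt_iff_lt.1 hij
  · funext x
    rcases x with i | b
    · by_cases hi : i ∈ S
      · change _ = p (σ (Sum.inl i))
        rw [hσmem i hi]
        change _ = φ (Sum.inl (e (e.symm ⟨i, hi⟩) : Fin m))
        rw [e.apply_symm_apply]
      · obtain ⟨b, hb⟩ := hnot i hi
        change _ = p (σ (Sum.inl i))
        rw [hσnot i hi b hb]
        exact hb
    · exact hφ b

end BSet

/-- Every doubly based map `φ : 𝐦_e → 𝐧_e` factors uniquely as `φ = p ∘ σ` with
`σ` singular and `p` effective. -/
theorem canonical_decomposition (m n : ℕ) (φ : BSet m → BSet n) (hφ : IsBased φ) :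
    ∃ (k : ℕ) (σ : BSet m → BSet k) (p : BSet k → BSet n),
      IsBased σ ∧ IsBased p ∧ Singular σ ∧ Effective p ∧ φ = p ∘ σ ∧
      ∀ (k' : ℕ) (σ' : BSet m → BSet k') (p' : BSet k' → BSet n),
        IsBased σ' → IsBased p' → Singular σ' → Effective p' → φ = p' ∘ σ' →
        k' = k ∧ HEq σ' σ ∧ HEq p' p := by
  obtain ⟨k, σ, p, hσ, hp, hs, hpe, rfl⟩ := BSet.exists_factorization hφ
  exact ⟨k, σ, p, hσ, hp, hs, hpe, rfl, fun _ _ _ hσ' hp' hs' hpe' h =>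
    BSet.factorization_unique hσ hp hs hpe hσ' hp' hs' hpe' h⟩
end

section
/- Let f ∈ 𝓡(m), let φ : Fin m → Fin n be a map, and suppose g := φ_*f ∈ 𝓡(n). Then f and g have the same type: the number of monomials in the support of f equals the number of monomials in the support of g, and the multiset of total degrees of the monomials of f equals the multiset of total degrees of the monomials of g. -/
open MvPolynomial

/-- The type of `f`: the multiset of total degrees of the monomials in the
support of `f`. -/
def polyType {n : ℕ} (f : MvPolynomial (Fin n) ℤ) : Multiset ℕ :=
  f.support.val.map fun I => I.sum fun _ e => e

/-- If all nonzero coefficients of `f` are `1`, the coefficient of `rename φ f` at `e` counts the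
monomials of `f` mapped to `e`. -/
theorem coeff_rename_eq_card_fiber {σ τ : Type*} [DecidableEq τ] (φ : σ → τ) (f : MvPolynomial σ ℤ)
    (hf : ∀ d ∈ f.support, f.coeff d = 1) (e : τ →₀ ℕ) :
    (rename φ f).coeff e = ((f.support.filter fun d => d.mapDomain φ = e).card : ℤ) := by
  conv_lhs => rw [f.as_sum]
  simp only [map_sum, rename_monomial, coeff_sum, coeff_monomial]
  rw [← Finset.sum_filter, Finset.sum_congr rfl fun d hd => hf d (Finset.mem_filter.mp hd).1]
  simp

/-- If all nonzero coefficients of `f` and of `rename φ f` are `1`, then `φ` acts injectively on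
the monomials of `f`. -/
theorem injOn_mapDomain_support {σ τ : Type*} (φ : σ → τ) (f : MvPolynomial σ ℤ)
    (hf : ∀ d ∈ f.support, f.coeff d = 1)
    (hg : ∀ e ∈ (rename φ f).support, (rename φ f).coeff e = 1) :
    Set.InjOn (Finsupp.mapDomain φ) (f.support : Set (σ →₀ ℕ)) := by
  classical
  intro a ha b hb hab
  have hcoeff := coeff_rename_eq_card_fiber φ f hf (a.mapDomain φ)
  have ha' : a ∈ f.support.filter fun d => d.mapDomain φ = a.mapDomain φ :=
    Finset.mem_filter.mpr ⟨ha, rfl⟩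
  have hb' : b ∈ f.support.filter fun d => d.mapDomain φ = a.mapDomain φ :=
    Finset.mem_filter.mpr ⟨hb, hab.symm⟩
  have hne : (rename φ f).coeff (a.mapDomain φ) ≠ 0 := by
    rw [hcoeff]
    exact_mod_cast Finset.card_ne_zero_of_mem ha'
  rw [hg _ (mem_support_iff.mpr hne)] at hcoeff
  exact Finset.card_le_one.mp (by exact_mod_cast hcoeff.symm.le) a ha' b hb'

/-- If all nonzero coefficients of `f` are `1`, no monomial of `f` cancels in `rename φ f`. -/
theorem support_rename_eq_image {σ τ : Type*} [DecidableEq τ] (φ : σ → τ) (f : MvPolynomial σ ℤ)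
    (hf : ∀ d ∈ f.support, f.coeff d = 1) :
    (rename φ f).support = f.support.image (Finsupp.mapDomain φ) := by
  ext e
  rw [mem_support_iff, coeff_rename_eq_card_fiber φ f hf, Nat.cast_ne_zero, Finset.card_ne_zero,
    Finset.filter_nonempty_iff, Finset.mem_image]

/-- If `f ∈ 𝓡(m)` and `g := φ_* f ∈ 𝓡(n)`, then `f` and `g` have the same
type: the same number of monomials, and the same multiset of total degrees
of monomials. -/
theorem rename_same_type (m n : ℕ) (φ : Fin m → Fin n)
    (f : MvPolynomial (Fin m) ℤ) (hf : IsRPoly f)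
    (hg : IsRPoly (MvPolynomial.rename φ f)) :
    f.support.card = (MvPolynomial.rename φ f).support.card ∧
    polyType f = polyType (MvPolynomial.rename φ f) := by
  have hinj := injOn_mapDomain_support φ f hf.1 hg.1
  have hsupp := support_rename_eq_image φ f hf.1
  refine ⟨by rw [hsupp, Finset.card_image_of_injOn hinj], ?_⟩
  rw [polyType, polyType, hsupp, Finset.image_val_of_injOn hinj, Multiset.map_map]
  refine Multiset.map_congr rfl fun d _ => ?_
  simp [Finsupp.sum_mapDomain_index]
end

section
/- Let f ∈ 𝓡(n) be special and let φ_1, φ_2 : Fin n → Fin N be two maps with φ_{1*}f = φ_{2*}f = h ∈ 𝓡(N). Then there exists a permutation σ of Fin n with σ_*f = f such that φ_1 ∘ σ = φ_2. -/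
open MvPolynomial

/-- The `j`-th block `B_j = {k₁+⋯+k_{j-1}+1, …, k₁+⋯+k_j}` of indices in
`Fin n`, for block sizes `k : Fin l → ℕ`. -/
def specialBlock {n l : ℕ} (k : Fin l → ℕ) (j : Fin l) : Finset (Fin n) :=
  Finset.univ.filter fun i : Fin n =>
    (∑ t ∈ Finset.univ.filter (fun t => t < j), k t) ≤ i.1 ∧
    i.1 < (∑ t ∈ Finset.univ.filter (fun t => t < j), k t) + k j

/-- `f ∈ 𝓡(n)` is special if
`f = a₁⋯a_{k₁} + a_{k₁+1}⋯a_{k₁+k₂} + ⋯ + a_{k₁+⋯+k_{l-1}+1}⋯a_n`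
for some `0 < k₁ ≤ k₂ ≤ ⋯ ≤ k_l` with `k₁ + ⋯ + k_l = n`. -/
def IsSpecial {n : ℕ} (f : MvPolynomial (Fin n) ℤ) : Prop :=
  ∃ (l : ℕ) (k : Fin l → ℕ), (∀ i, 0 < k i) ∧ Monotone k ∧ (∑ i, k i) = n ∧
    f = ∑ j : Fin l, ∏ i ∈ specialBlock k j, MvPolynomial.X i

/-- Two maps on a finite type whose fibres have the same sizes differ by a permutation. -/
theorem exists_perm_comp_eq_of_card_fiber_eq {α β : Type*} [Fintype α] [DecidableEq β]
    (f g : α → β)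
    (h : ∀ c, (Finset.univ.filter fun a => f a = c).card =
      (Finset.univ.filter fun a => g a = c).card) :
    ∃ σ : Equiv.Perm α, ∀ a, f (σ a) = g a := by
  have e : ∀ c, Nonempty ({a // g a = c} ≃ {a // f a = c}) := fun c => by
    rw [← Fintype.card_eq, Fintype.card_subtype, Fintype.card_subtype, h c]
  exact ⟨Equiv.ofFiberEquiv fun c => (e c).some, fun a => Equiv.ofFiberEquiv_map _ a⟩

theorem sum_filter_lt_eq_sum_castLE {l : ℕ} (k : Fin l → ℕ) (j : Fin l) :
    ∑ t ∈ Finset.univ.filter (fun t => t < j), k t =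
      ∑ t : Fin j.1, k (Fin.castLE j.2.le t) := by
  symm
  refine Finset.sum_bij (fun t _ => Fin.castLE j.2.le t) ?_ ?_ ?_ ?_
  · intro t _
    simpa using Fin.lt_def.2 t.2
  · intro s _ t _ hst
    simpa using hst
  · intro t ht
    have ht' : t < j := by simpa using ht
    exact ⟨⟨t.1, ht'⟩, Finset.mem_univ _, rfl⟩
  · intro t _
    rfl

/-- The blocks partition `Fin n`: they are the fibres of a map to the set of block indices. -/
theorem exists_mem_specialBlock_iff {n l : ℕ} (k : Fin l → ℕ) (hk : ∑ i, k i = n) :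
    ∃ b : Fin n → Fin l, ∀ i j, i ∈ specialBlock k j ↔ b i = j := by
  subst hk
  refine ⟨fun i => (finSigmaFinEquiv.symm i).1, fun i j => ?_⟩
  simp only [specialBlock, Finset.mem_filter, Finset.mem_univ, true_and,
    sum_filter_lt_eq_sum_castLE]
  constructor
  · rintro ⟨h₁, h₂⟩
    have : finSigmaFinEquiv
        (⟨j, ⟨i.1 - ∑ t : Fin j.1, k (Fin.castLE j.2.le t), by omega⟩⟩ :
          (j : Fin l) × Fin (k j)) = i := by
      apply Fin.ext
      rw [finSigmaFinEquiv_apply]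
      dsimp only
      omega
    rw [← this, Equiv.symm_apply_apply]
  · rintro rfl
    obtain ⟨⟨j, r⟩, rfl⟩ := finSigmaFinEquiv.surjective i
    rw [Equiv.symm_apply_apply, finSigmaFinEquiv_apply]
    have := r.2
    dsimp only
    omega

theorem prod_X_comp_eq_monomial {σ τ : Type*} (s : Finset σ) (φ : σ → τ) :
    ∏ i ∈ s, (X (φ i) : MvPolynomial τ ℤ) = monomial (∑ i ∈ s, Finsupp.single (φ i) 1) 1 := by
  rw [monomial_sum_one]
  rfl

theorem coeff_rename_sum_prod_X {σ τ ι : Type*} [Fintype ι] [DecidableEq τ] (B : ι → Finset σ)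
    (φ : σ → τ) (d : τ →₀ ℕ) :
    coeff d (rename φ (∑ j, ∏ i ∈ B j, (X i : MvPolynomial σ ℤ))) =
      (Finset.univ.filter fun j => ∑ i ∈ B j, Finsupp.single (φ i) 1 = d).card := by
  simp only [map_sum, map_prod, rename_X, prod_X_comp_eq_monomial, coeff_sum, coeff_monomial,
    Finset.sum_boole]

theorem sum_single_one_apply {σ τ : Type*} [DecidableEq τ] (s : Finset σ) (φ : σ → τ) (x : τ) :
    (∑ i ∈ s, Finsupp.single (φ i) 1 : τ →₀ ℕ) x = (s.filter fun i => φ i = x).card := by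
  simp [Finsupp.finsetSum_apply, Finsupp.single_apply]


/-- If `f ∈ 𝓡(n)` is special and `φ₁, φ₂ : Fin n → Fin N` satisfy
`φ₁_* f = φ₂_* f = h ∈ 𝓡(N)`, then there is a permutation `σ` of `Fin n` with
`σ_* f = f` and `φ₁ ∘ σ = φ₂`. -/
theorem special_pullback (n N : ℕ) (f : MvPolynomial (Fin n) ℤ)
    (hf : IsRPoly f) (hsp : IsSpecial f)
    (φ₁ φ₂ : Fin n → Fin N)
    (hh : IsRPoly (MvPolynomial.rename φ₁ f))
    (heq : MvPolynomial.rename φ₁ f = MvPolynomial.rename φ₂ f) :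
    ∃ σ : Equiv.Perm (Fin n),
      MvPolynomial.rename (σ : Fin n → Fin n) f = f ∧ φ₁ ∘ σ = φ₂ := by
  obtain ⟨l, k, -, -, hk, rfl⟩ := hsp
  obtain ⟨b, hb⟩ := exists_mem_specialBlock_iff k hk
  obtain ⟨π, hπ⟩ := exists_perm_comp_eq_of_card_fiber_eq
    (fun j => (∑ i ∈ specialBlock k j, Finsupp.single (φ₁ i) 1 : Fin N →₀ ℕ))
    (fun j => ∑ i ∈ specialBlock k j, Finsupp.single (φ₂ i) 1) fun d => by
      have := congrArg (coeff d) heq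
      rw [coeff_rename_sum_prod_X, coeff_rename_sum_prod_X] at this
      exact_mod_cast this
  obtain ⟨σ, hσ⟩ := exists_perm_comp_eq_of_card_fiber_eq
    (fun i => (b i, φ₁ i)) (fun i => (π (b i), φ₂ i)) fun ⟨j, x⟩ => by
      obtain ⟨j, rfl⟩ := π.surjective j
      have := DFunLike.congr_fun (hπ j) x
      rw [sum_single_one_apply, sum_single_one_apply] at this
      convert this using 2 <;> ext i <;> simp [hb]
  simp only [Prod.mk.injEq] at hσ
  refine ⟨σ, ?_, funext fun i => (hσ i).2⟩
  simp only [map_sum, map_prod, rename_X]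
  refine Fintype.sum_equiv π _ _ fun j => Finset.prod_equiv σ (fun i => ?_) fun i _ => rfl
  rw [hb, hb, (hσ i).1, π.injective.eq_iff]
end

section
/- For every f ∈ 𝓡(n) there exists a special polynomial g ∈ 𝓡(N) (for some N) and a map φ : Fin N → Fin n with φ_*g = f. Moreover g is unique: if g ∈ 𝓡(N) and g' ∈ 𝓡(N') are both special and both admit maps φ, φ' with φ_*g = f = φ'_*g', then N = N' and g = g'. -/
open MvPolynomial

lemma finSigmaFinEquiv_val {l : ℕ} (k : Fin l → ℕ) (j : Fin l) (x : Fin (k j)) :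
    (finSigmaFinEquiv ⟨j, x⟩ : Fin (∑ i, k i)).1 =
      ∑ t ∈ Finset.univ.filter (fun t => t < j), k t + x.1 := by
  rw [finSigmaFinEquiv_apply]
  congr 1
  refine Finset.sum_bij (fun i _ => Fin.castLE j.2.le i) ?_ ?_ ?_ ?_
  · intro i _
    rw [Finset.mem_filter]
    exact ⟨Finset.mem_univ _, i.2⟩
  · intro a _ b _ h
    exact Fin.castLE_injective _ h
  · intro b hb
    exact ⟨⟨b.1, (Finset.mem_filter.1 hb).2⟩, Finset.mem_univ _, rfl⟩
  · intro i _
    rfl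

lemma sum_filter_lt_add_le {l : ℕ} (k : Fin l → ℕ) {i j : Fin l} (h : i < j) :
    ∑ t ∈ Finset.univ.filter (fun t => t < i), k t + k i ≤
      ∑ t ∈ Finset.univ.filter (fun t => t < j), k t := by
  rw [add_comm, ← Finset.sum_insert (by simp)]
  refine Finset.sum_le_sum_of_subset fun t ht => ?_
  simp only [Finset.mem_insert, Finset.mem_filter, Finset.mem_univ, true_and] at ht ⊢
  rcases ht with rfl | ht
  · exact h
  · exact ht.trans h

lemma finSigmaFinEquiv_mem_specialBlock {l : ℕ} (k : Fin l → ℕ) (i j : Fin l) (x : Fin (k i)) :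
    (finSigmaFinEquiv ⟨i, x⟩ : Fin (∑ i, k i)) ∈ specialBlock k j ↔ i = j := by
  simp only [specialBlock, Finset.mem_filter, Finset.mem_univ, true_and, finSigmaFinEquiv_val]
  have hx := x.2
  constructor
  · rintro ⟨h₁, h₂⟩
    rcases lt_trichotomy i j with h | h | h
    · have := sum_filter_lt_add_le k h
      omega
    · exact h
    · have := sum_filter_lt_add_le k h
      omega
  · rintro rfl
    omega

lemma prod_specialBlock {l : ℕ} (k : Fin l → ℕ) (j : Fin l) {M : Type*} [CommMonoid M]
    (F : Fin (∑ i, k i) → M) :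
    ∏ i ∈ specialBlock k j, F i = ∏ x : Fin (k j), F (finSigmaFinEquiv ⟨j, x⟩) := by
  symm
  refine Finset.prod_bij (fun x _ => finSigmaFinEquiv ⟨j, x⟩) ?_ ?_ ?_ ?_
  · intro x _
    rw [finSigmaFinEquiv_mem_specialBlock]
  · intro x _ y _ h
    simpa using h
  · intro b hb
    obtain ⟨⟨i, x⟩, rfl⟩ := finSigmaFinEquiv.surjective b
    obtain rfl := (finSigmaFinEquiv_mem_specialBlock k i j x).1 hb
    exact ⟨x, Finset.mem_univ _, rfl⟩
  · intro x _
    rfl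

lemma isRPoly_sum_monomial {n : ℕ} {ι : Type*} [Fintype ι] (D : ι → Fin n →₀ ℕ)
    (hD : Function.Injective D) (hle : ∀ j i, D j i ≤ 1) (h0 : ∀ j, D j ≠ 0) :
    IsRPoly (∑ j, monomial (D j) (1 : ℤ)) := by
  classical
  have hcoeff : ∀ j, coeff (D j) (∑ j, monomial (D j) (1 : ℤ)) = 1 := by
    intro j
    simp [coeff_sum, coeff_monomial, hD.eq_iff]
  have hzero : ∀ d, (∀ j, D j ≠ d) → coeff d (∑ j, monomial (D j) (1 : ℤ)) = 0 := by
    intro d hd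
    simp [coeff_sum, coeff_monomial, hd]
  have hmem : ∀ d ∈ (∑ j, monomial (D j) (1 : ℤ)).support, ∃ j, D j = d := by
    intro d hd
    by_contra! h
    exact mem_support_iff.1 hd (hzero d h)
  refine ⟨fun d hd => ?_, fun d hd => ?_, hzero 0 h0⟩
  · obtain ⟨j, rfl⟩ := hmem d hd
    exact hcoeff j
  · obtain ⟨j, rfl⟩ := hmem d hd
    exact hle j

lemma isRPoly_sum_prod_specialBlock {l : ℕ} (k : Fin l → ℕ) (hk : ∀ j, 0 < k j) :
    IsRPoly (∑ j : Fin l, ∏ i ∈ specialBlock (n := ∑ j, k j) k j,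
      (X i : MvPolynomial (Fin (∑ j, k j)) ℤ)) := by
  classical
  let D : Fin l → Fin (∑ j, k j) →₀ ℕ := fun j =>
    ∑ i ∈ specialBlock k j, Finsupp.single i 1
  have happ : ∀ j i, D j i = if i ∈ specialBlock k j then 1 else 0 := by
    intro j i
    simp [D, Finsupp.finsetSum_apply, Finsupp.single_apply]
  have hself : ∀ i j, D j (finSigmaFinEquiv ⟨i, ⟨0, hk i⟩⟩) = if i = j then 1 else 0 := by
    intro i j
    simp only [happ, finSigmaFinEquiv_mem_specialBlock]
  have hprod : ∀ j, ∏ i ∈ specialBlock k j, (X i : MvPolynomial (Fin (∑ j, k j)) ℤ) =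
      monomial (D j) 1 := by
    intro j
    simp only [D, monomial_sum_one]
    rfl
  simp only [hprod]
  refine isRPoly_sum_monomial D (fun i j h => ?_) (fun j i => ?_) fun j h => ?_
  · by_contra hne
    have := hself i j
    rw [← h, hself, if_pos rfl, if_neg hne] at this
    exact one_ne_zero this
  · rw [happ]
    split_ifs <;> simp
  · have := hself j j
    simp [h] at this

lemma exists_prod_X_eq_monomial {n : ℕ} (d : Fin n →₀ ℕ) (hd : ∀ i, d i ≤ 1) :
    ∃ ψ : Fin d.degree → Fin n, ∏ x, (X (ψ x) : MvPolynomial (Fin n) ℤ) = monomial d 1 := by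
  have h1 : ∀ i ∈ d.support, d i = 1 := fun i hi =>
    le_antisymm (hd i) (Nat.one_le_iff_ne_zero.2 (Finsupp.mem_support_iff.1 hi))
  have hcard : d.support.card = d.degree := by
    rw [Finsupp.degree_apply, Finset.card_eq_sum_ones]
    exact Finset.sum_congr rfl fun i hi => (h1 i hi).symm
  let e := d.support.equivFinOfCardEq hcard
  refine ⟨fun x => (e.symm x).1, ?_⟩
  rw [e.symm.prod_comp (fun i : d.support => (X i.1 : MvPolynomial (Fin n) ℤ)),
    Finset.prod_coe_sort d.support (fun i => (X i : MvPolynomial (Fin n) ℤ)), monomial_eq]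
  simp only [C_1, one_mul, Finsupp.prod]
  exact Finset.prod_congr rfl fun i hi => by rw [h1 i hi, pow_one]

lemma exists_special_representative {n : ℕ} {f : MvPolynomial (Fin n) ℤ} (hf : IsRPoly f) :
    ∃ (N : ℕ) (g : MvPolynomial (Fin N) ℤ), IsRPoly g ∧ IsSpecial g ∧
      ∃ φ : Fin N → Fin n, rename φ g = f := by
  let e := f.support.equivFin.symm
  let σ := Tuple.sort fun j => (e j).1.degree
  let d : Fin f.support.card → Fin n →₀ ℕ := fun j => (e (σ j)).1
  have hd : ∀ j, d j ∈ f.support := fun j => (e (σ j)).2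
  let k : Fin f.support.card → ℕ := fun j => (d j).degree
  have hmono : Monotone k := Tuple.monotone_sort fun j => (e j).1.degree
  have hpos : ∀ j, 0 < k j := by
    intro j
    refine Nat.pos_of_ne_zero fun h => ?_
    have h0 : d j = 0 := (Finsupp.degree_eq_zero_iff _).1 h
    exact mem_support_iff.1 (hd j) (h0 ▸ hf.2.2)
  choose ψ hψ using fun j => exists_prod_X_eq_monomial (d j) (hf.2.1 _ (hd j))
  let φ : Fin (∑ j, k j) → Fin n :=
    (fun p : Σ j, Fin (k j) => ψ p.1 p.2) ∘ finSigmaFinEquiv.symm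
  have hφ : ∀ j x, φ (finSigmaFinEquiv ⟨j, x⟩) = ψ j x := fun j x =>
    congrArg (fun p : Σ j, Fin (k j) => ψ p.1 p.2) (finSigmaFinEquiv.symm_apply_apply ⟨j, x⟩)
  refine ⟨∑ j, k j, _, isRPoly_sum_prod_specialBlock k hpos, ⟨_, k, hpos, hmono, rfl, rfl⟩, φ, ?_⟩
  simp only [map_sum, map_prod, rename_X, prod_specialBlock, hφ]
  calc ∑ j, ∏ x, X (ψ j x) = ∑ j, monomial (d j) (coeff (d j) f) :=
        Finset.sum_congr rfl fun j _ => by rw [hψ, hf.1 _ (hd j)]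
    _ = ∑ v : f.support, monomial v.1 (coeff v.1 f) :=
        (σ.trans e).sum_comp fun v : f.support => monomial v.1 (coeff v.1 f)
    _ = f := by
        rw [Finset.sum_coe_sort f.support fun v => monomial v (coeff v f)]
        exact f.as_sum.symm

lemma aeval_rename_sum_prod_specialBlock {n l : ℕ} (k : Fin l → ℕ)
    (φ : Fin (∑ j, k j) → Fin n) :
    aeval (fun _ => (Polynomial.X : Polynomial ℤ))
      (rename φ (∑ j : Fin l, ∏ i ∈ specialBlock (n := ∑ j, k j) k j,
        (X i : MvPolynomial (Fin (∑ j, k j)) ℤ))) = ∑ j, Polynomial.X ^ k j := by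
  simp [prod_specialBlock]

lemma ofFn_eq_of_sum_X_pow_eq {l l' : ℕ} {k : Fin l → ℕ} {k' : Fin l' → ℕ}
    (hk : Monotone k) (hk' : Monotone k')
    (h : ∑ j, (Polynomial.X : Polynomial ℤ) ^ k j = ∑ j, Polynomial.X ^ k' j) :
    List.ofFn k = List.ofFn k' := by
  have hcount : ∀ {m : ℕ} (u : Fin m → ℕ) (a : ℕ), ((List.ofFn u).count a : ℤ) =
      (∑ j, (Polynomial.X : Polynomial ℤ) ^ u j).coeff a := by
    intro m u a
    induction m with
    | zero => simp
    | succ m ih =>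
      rw [List.ofFn_succ, Fin.sum_univ_succ, Polynomial.coeff_add, ← ih, List.count_cons,
        Polynomial.coeff_X_pow]
      by_cases ha : a = u 0
      · simp [ha, add_comm]
      · simp [ha, Ne.symm ha]
  have hperm : (List.ofFn k).Perm (List.ofFn k') := by
    rw [List.perm_iff_count]
    intro a
    have := hcount k a
    rw [h, ← hcount k' a] at this
    exact_mod_cast this
  exact hperm.eq_of_sortedLE hk.sortedLE_ofFn hk'.sortedLE_ofFn

/-- Every `f ∈ 𝓡(n)` is the pushforward of a unique special polynomial:
there exist `N`, a special `g ∈ 𝓡(N)` and `φ : Fin N → Fin n` with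
`φ_* g = f`; moreover such a special `g` is unique. -/
theorem special_representative (n : ℕ) (f : MvPolynomial (Fin n) ℤ)
    (hf : IsRPoly f) :
    (∃ (N : ℕ) (g : MvPolynomial (Fin N) ℤ), IsRPoly g ∧ IsSpecial g ∧
      ∃ φ : Fin N → Fin n, MvPolynomial.rename φ g = f) ∧
    (∀ (N N' : ℕ) (g : MvPolynomial (Fin N) ℤ) (g' : MvPolynomial (Fin N') ℤ),
      IsRPoly g → IsSpecial g → IsRPoly g' → IsSpecial g' →
      (∃ φ : Fin N → Fin n, MvPolynomial.rename φ g = f) →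
      (∃ φ' : Fin N' → Fin n, MvPolynomial.rename φ' g' = f) →
      N = N' ∧ HEq g g') := by
  refine ⟨exists_special_representative hf, ?_⟩
  rintro N N' g g' - ⟨l, k, -, hk, rfl, rfl⟩ - ⟨l', k', -, hk', rfl, rfl⟩ ⟨φ, hφ⟩ ⟨φ', hφ'⟩
  have hsum := aeval_rename_sum_prod_specialBlock k φ
  rw [hφ, ← hφ', aeval_rename_sum_prod_specialBlock] at hsum
  have hlist := ofFn_eq_of_sum_X_pow_eq hk' hk hsum
  rw [List.ofFn_inj'] at hlist
  cases hlist
  exact ⟨rfl, HEq.rfl⟩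
end

section
/- Let f ∈ 𝓡(m) be non-degenerate and let σ : 𝐦_e → 𝐧_e be a singular map such that σ(i) ∈ {0, e} for some i ∈ {1,…,m}. If σ_*f ∈ 𝓡(n), then the total degree strictly decreases: the sum of the total degrees of the monomials of f is strictly greater than the sum of the total degrees of the monomials of σ_*f. -/
open MvPolynomial

/-- `f` is non-degenerate if every variable occurs in `f`,
i.e. `∂f/∂a_s ≠ 0` for all `s`. -/
def NonDegen {n : ℕ} (f : MvPolynomial (Fin n) ℤ) : Prop :=
  ∀ s : Fin n, MvPolynomial.pderiv s f ≠ 0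

/-- The pushforward of `f ∈ ℤ[a₁,…,a_m]` along a doubly based map
`φ : 𝐦_e → 𝐧_e`: substitute `a_{φ(i)}` for `a_i`, where `a_0 := 0`
and `a_e := 1`. -/
noncomputable def bpush {m n : ℕ} (φ : BSet m → BSet n)
    (f : MvPolynomial (Fin m) ℤ) : MvPolynomial (Fin n) ℤ :=
  MvPolynomial.aeval (fun i : Fin m =>
    match φ (Sum.inl i) with
    | Sum.inl j => MvPolynomial.X j
    | Sum.inr false => 0
    | Sum.inr true => 1) f

/-- The sum of the total degrees of the monomials of `f`. -/
def totalDegSum {n : ℕ} (f : MvPolynomial (Fin n) ℤ) : ℕ :=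
  (f.support.val.map fun I => I.sum fun _ e => e).sum

/-- The linear functional sending a monomial to its total degree. -/
noncomputable def degreeFunctional (n : ℕ) : MvPolynomial (Fin n) ℤ →ₗ[ℤ] ℤ :=
  (basisMonomials (Fin n) ℤ).constr ℤ fun d => (d.degree : ℤ)

lemma degreeFunctional_monomial {n : ℕ} (d : Fin n →₀ ℕ) (c : ℤ) :
    degreeFunctional n (monomial d c) = c * d.degree := by
  have h : degreeFunctional n (monomial d 1) = d.degree := by
    have := (basisMonomials (Fin n) ℤ).constr_basis ℤ (fun d => (d.degree : ℤ)) d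
    simpa [degreeFunctional] using this
  rw [← mul_one c, ← smul_eq_mul, ← smul_monomial, map_smul, h]
  simp

lemma coe_totalDegSum {n : ℕ} (f : MvPolynomial (Fin n) ℤ) :
    (totalDegSum f : ℤ) = ∑ d ∈ f.support, (d.degree : ℤ) := by
  have h : totalDegSum f = ∑ d ∈ f.support, d.degree := rfl
  rw [h, Nat.cast_sum]

lemma coe_totalDegSum_eq_degreeFunctional {n : ℕ} {f : MvPolynomial (Fin n) ℤ}
    (hf : IsRPoly f) : (totalDegSum f : ℤ) = degreeFunctional n f := by
  conv_rhs => rw [f.as_sum]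
  rw [coe_totalDegSum, map_sum]
  refine Finset.sum_congr rfl fun d hd => ?_
  rw [degreeFunctional_monomial, hf.1 d hd, one_mul]

lemma prod_monomial_pow {ι κ : Type*} (s : Finset ι) (w : ι → κ →₀ ℕ) (c : ι → ℤ)
    (d : ι → ℕ) :
    ∏ i ∈ s, monomial (w i) (c i) ^ d i =
      monomial (∑ i ∈ s, d i • w i) (∏ i ∈ s, c i ^ d i) := by
  classical
  induction s using Finset.induction_on with
  | empty => simp
  | insert a s ha ih =>
    rw [Finset.prod_insert ha, ih, monomial_pow, monomial_mul, Finset.sum_insert ha,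
      Finset.prod_insert ha]

lemma NonDegen.exists_mem_support {n : ℕ} {f : MvPolynomial (Fin n) ℤ} (hf : NonDegen f)
    (s : Fin n) : ∃ d ∈ f.support, d s ≠ 0 := by
  by_contra! h
  refine hf s ?_
  rw [f.as_sum, map_sum]
  refine Finset.sum_eq_zero fun d hd => ?_
  rw [pderiv_monomial, h d hd]
  simp

/-- The exponent vector of the monomial substituted for a variable with the given image. -/
noncomputable def imageExponent {n : ℕ} : BSet n → Fin n →₀ ℕ
  | Sum.inl j => Finsupp.single j 1
  | Sum.inr _ => 0

/-- The coefficient of the monomial substituted for a variable with the given image. -/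
def imageCoeff {n : ℕ} : BSet n → ℤ
  | Sum.inr false => 0
  | _ => 1

lemma degree_imageExponent_le {n : ℕ} (x : BSet n) : (imageExponent x).degree ≤ 1 := by
  rcases x with j | b <;> simp [imageExponent]

lemma imageCoeff_nonneg {n : ℕ} (x : BSet n) : 0 ≤ imageCoeff x := by
  rcases x with j | _ | _ <;> simp [imageCoeff]

lemma imageCoeff_le_one {n : ℕ} (x : BSet n) : imageCoeff x ≤ 1 := by
  rcases x with j | _ | _ <;> simp [imageCoeff]

lemma bpush_monomial {m n : ℕ} (φ : BSet m → BSet n) (d : Fin m →₀ ℕ) :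
    bpush φ (monomial d 1) =
      monomial (∑ i, d i • imageExponent (φ (Sum.inl i)))
        (∏ i, imageCoeff (φ (Sum.inl i)) ^ d i) := by
  rw [← prod_monomial_pow, bpush, aeval_monomial, map_one, one_mul,
    Finsupp.prod_fintype _ _ fun _ => pow_zero _]
  refine Finset.prod_congr rfl fun i _ => ?_
  congr 1
  rcases φ (Sum.inl i) with j | _ | _ <;> simp [imageExponent, imageCoeff, X]

lemma degreeFunctional_bpush_monomial_le {m n : ℕ} (φ : BSet m → BSet n) (d : Fin m →₀ ℕ) :
    degreeFunctional n (bpush φ (monomial d 1)) ≤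
      ∑ i, (d i : ℤ) * (imageExponent (φ (Sum.inl i))).degree := by
  rw [bpush_monomial, degreeFunctional_monomial]
  have hc : ∏ i, imageCoeff (φ (Sum.inl i)) ^ d i ≤ 1 :=
    Finset.prod_le_one (fun i _ => pow_nonneg (imageCoeff_nonneg _) _)
      fun i _ => pow_le_one₀ (imageCoeff_nonneg _) (imageCoeff_le_one _)
  refine (mul_le_of_le_one_left (Int.natCast_nonneg _) hc).trans_eq ?_
  simp [map_sum, map_nsmul]

lemma degreeFunctional_bpush_monomial_le_degree {m n : ℕ} (φ : BSet m → BSet n)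
    (d : Fin m →₀ ℕ) : degreeFunctional n (bpush φ (monomial d 1)) ≤ d.degree := by
  refine (degreeFunctional_bpush_monomial_le φ d).trans ?_
  rw [Finsupp.degree_eq_sum, Nat.cast_sum]
  refine Finset.sum_le_sum fun i _ => mul_le_of_le_one_right (Int.natCast_nonneg _) ?_
  exact_mod_cast degree_imageExponent_le _

lemma degreeFunctional_bpush_monomial_lt_degree {m n : ℕ} (φ : BSet m → BSet n)
    (d : Fin m →₀ ℕ) {i : Fin m} (hd : d i ≠ 0) {b : Bool} (hi : φ (Sum.inl i) = Sum.inr b) :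
    degreeFunctional n (bpush φ (monomial d 1)) < d.degree := by
  refine (degreeFunctional_bpush_monomial_le φ d).trans_lt ?_
  rw [Finsupp.degree_eq_sum, Nat.cast_sum]
  refine Finset.sum_lt_sum (fun i _ => mul_le_of_le_one_right (Int.natCast_nonneg _) ?_)
    ⟨i, Finset.mem_univ i, ?_⟩
  · exact_mod_cast degree_imageExponent_le _
  · rw [hi]
    simpa [imageExponent] using Nat.pos_of_ne_zero hd

lemma IsRPoly.bpush_eq_sum {m n : ℕ} {f : MvPolynomial (Fin m) ℤ} (hf : IsRPoly f)
    (φ : BSet m → BSet n) : bpush φ f = ∑ d ∈ f.support, bpush φ (monomial d 1) := by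
  conv_lhs => rw [f.as_sum, bpush, map_sum]
  exact Finset.sum_congr rfl fun d hd => by rw [hf.1 d hd, bpush]

/-- If `f ∈ 𝓡(m)` is non-degenerate and `σ` is a singular doubly based map
sending some `i ∈ {1,…,m}` to a basepoint, and `σ_* f ∈ 𝓡(n)`, then the sum
of the total degrees of the monomials strictly decreases. -/
theorem singular_strictly_decreases_degree (m n : ℕ)
    (f : MvPolynomial (Fin m) ℤ) (hf : IsRPoly f) (hnd : NonDegen f)
    (σ : BSet m → BSet n) (hb : IsBased σ) (hs : Singular σ)
    (hi : ∃ (i : Fin m) (b : Bool), σ (Sum.inl i) = Sum.inr b)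
    (hg : IsRPoly (bpush σ f)) :
    totalDegSum (bpush σ f) < totalDegSum f := by
  obtain ⟨i, b, hi⟩ := hi
  obtain ⟨d, hd, hdi⟩ := hnd.exists_mem_support i
  rw [← Nat.cast_lt (α := ℤ), coe_totalDegSum_eq_degreeFunctional hg, coe_totalDegSum,
    hf.bpush_eq_sum, map_sum]
  exact Finset.sum_lt_sum (fun d _ => degreeFunctional_bpush_monomial_le_degree σ d)
    ⟨d, hd, degreeFunctional_bpush_monomial_lt_degree σ d hdi hi⟩
end

section
/- Let f_m ∈ 𝓡(m), f_n ∈ 𝓡(n), and let φ : 𝐦_e → 𝐧_e be a doubly based map with φ_*f_m = f_n. Then for each monomial J in the support of f_n there exists a unique monomial I in the support of f_m with φ_*(∏_{i∈I} a_i) = ∏_{j∈J} a_j; this assignment defines an injection φ' from the support of f_n into the support of f_m. Moreover, for each such J and each j in the variable-set Γ_J of J, there is a unique i in the variable-set Γ_{φ'(J)} with φ(i) = j, so that φ induces an injection Γ_J → Γ_{φ'(J)}. -/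
open MvPolynomial

open Classical in
/-- The pushforward of a monic monomial is zero or a monic monomial, whose exponent at `j` is the
sum of the original exponents over the fibre of `j`. -/
theorem bpush_monomial_eq_zero_or {m n : ℕ} (φ : BSet m → BSet n) (I : Fin m →₀ ℕ) :
    bpush φ (monomial I 1) = 0 ∨ ∃ J : Fin n →₀ ℕ, bpush φ (monomial I 1) = monomial J 1 ∧
      ∀ j, J j = ∑ i with φ (Sum.inl i) = Sum.inl j, I i := by
  induction I using Finsupp.induction_linear with
  | zero => exact Or.inr ⟨0, by simp [bpush], by simp⟩
  | add I I' h h' =>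
    have hmul : bpush φ (monomial (I + I') 1) =
        bpush φ (monomial I 1) * bpush φ (monomial I' 1) := by
      rw [bpush, bpush, bpush, ← map_mul, monomial_mul, one_mul]
    rcases h with h | ⟨J, h, hJ⟩
    · exact Or.inl (by rw [hmul, h, zero_mul])
    rcases h' with h' | ⟨J', h', hJ'⟩
    · exact Or.inl (by rw [hmul, h', mul_zero])
    refine Or.inr ⟨J + J', by rw [hmul, h, h', monomial_mul, one_mul], fun j => ?_⟩
    simp [hJ, hJ', Finset.sum_add_distrib]
  | single i k =>
    rcases Nat.eq_zero_or_pos k with rfl | hk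
    · exact Or.inr ⟨0, by simp [bpush], by simp⟩
    have haeval (g : Fin m → MvPolynomial (Fin n) ℤ) :
        aeval g (monomial (Finsupp.single i k) (1 : ℤ)) = g i ^ k := by
      rw [← X_pow_eq_monomial, map_pow, aeval_X]
    have hpush : bpush φ (monomial (Finsupp.single i k) 1) = (match φ (Sum.inl i) with
      | Sum.inl j => (X j : MvPolynomial (Fin n) ℤ)
      | Sum.inr false => 0
      | Sum.inr true => 1) ^ k := haeval _
    rcases hi : φ (Sum.inl i) with j | (_ | _) <;> rw [hi] at hpush
    · refine Or.inr ⟨Finsupp.single j k, hpush.trans (X_pow_eq_monomial ..), fun j' => ?_⟩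
      rw [Finset.sum_filter, Finset.sum_eq_single i]
      · rw [hi, Finsupp.single_apply, Finsupp.single_eq_same]
        exact if_congr Sum.inl_injective.eq_iff.symm rfl rfl
      · intro i' _ hne
        simp [hne.symm]
      · simp
    · exact Or.inl (hpush.trans (zero_pow hk.ne'))
    · refine Or.inr ⟨0, hpush.trans (one_pow k), fun j => ?_⟩
      rw [Finset.sum_filter, Finset.sum_eq_single i]
      · exact (if_neg fun h => Sum.inr_ne_inl (hi.symm.trans h)).symm
      · intro i' _ hne
        simp [hne.symm]
      · simp

open Classical in
theorem coeff_bpush_monomial {m n : ℕ} (φ : BSet m → BSet n) (I : Fin m →₀ ℕ)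
    (J : Fin n →₀ ℕ) :
    coeff J (bpush φ (monomial I 1)) =
      if bpush φ (monomial I 1) = monomial J 1 then 1 else 0 := by
  rcases bpush_monomial_eq_zero_or φ I with h | ⟨J', h, -⟩
  · rw [h, coeff_zero, if_neg (Ne.symm (by simp))]
  · rw [h, coeff_monomial]
    exact if_congr (monomial_left_inj one_ne_zero).symm rfl rfl

open Classical in
/-- If all coefficients of `f` are `1`, then the coefficients of its pushforward count the
monomials of `f` in the fibres. -/
theorem coeff_bpush {m n : ℕ} (φ : BSet m → BSet n) {f : MvPolynomial (Fin m) ℤ}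
    (hf : ∀ d ∈ f.support, f.coeff d = 1) (J : Fin n →₀ ℕ) :
    coeff J (bpush φ f) =
      (f.support.filter fun I => bpush φ (monomial I 1) = monomial J 1).card := by
  have hsum : bpush φ f = ∑ I ∈ f.support, bpush φ (monomial I 1) := by
    conv_lhs => rw [← support_sum_monomial_coeff f]
    simp only [bpush, map_sum]
    exact Finset.sum_congr rfl fun I hI => by rw [hf I hI]
  rw [hsum, coeff_sum]
  simp only [coeff_bpush_monomial, Finset.sum_boole]

/-- A variable occurring exactly once in the pushforward of a monomial comes from a unique variable
of that monomial. -/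
theorem existsUnique_preimage_of_bpush_monomial {m n : ℕ} {φ : BSet m → BSet n}
    {I : Fin m →₀ ℕ} {J : Fin n →₀ ℕ} (h : bpush φ (monomial I 1) = monomial J 1)
    {j : Fin n} (hj : J j = 1) :
    ∃! i : Fin m, i ∈ I.support ∧ φ (Sum.inl i) = Sum.inl j := by
  classical
  rcases bpush_monomial_eq_zero_or φ I with h0 | ⟨J', h', hJ'⟩
  · exact absurd (h.symm.trans h0) (by simp)
  obtain rfl : J' = J := monomial_left_injective one_ne_zero (h'.symm.trans h)
  have hsum := (hJ' j).symm.trans hj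
  obtain ⟨i, hi, hi0⟩ := Finset.exists_ne_zero_of_sum_ne_zero (hsum.trans_ne one_ne_zero)
  refine ⟨i, ⟨Finsupp.mem_support_iff.mpr hi0, (Finset.mem_filter.mp hi).2⟩, ?_⟩
  rintro i' ⟨hi', hφ⟩
  by_contra hne
  have hle := Finset.add_le_sum (f := I) (fun _ _ => Nat.zero_le _) hi
    (Finset.mem_filter.mpr ⟨Finset.mem_univ i', hφ⟩) (Ne.symm hne)
  have := Finsupp.mem_support_iff.mp hi'
  omega

/-- Let `f_m ∈ 𝓡(m)`, `f_n ∈ 𝓡(n)` and `φ` doubly based with `φ_* f_m = f_n`.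
Each monomial `J` of `f_n` is the pushforward of a unique monomial `I` of
`f_m`; this gives an injection `φ'` from the support of `f_n` into the support
of `f_m`, and for every `j` in the variable-set of `J` there is a unique
`i` in the variable-set of `φ'(J)` with `φ(i) = j`, so `φ` induces an
injection `Γ_J → Γ_{φ'(J)}`. -/
theorem monomial_lift (m n : ℕ)
    (fm : MvPolynomial (Fin m) ℤ) (fn : MvPolynomial (Fin n) ℤ)
    (hm : IsRPoly fm) (hn : IsRPoly fn)
    (φ : BSet m → BSet n) (hb : IsBased φ) (heq : bpush φ fm = fn) :
    (∀ J ∈ fn.support, ∃! I : Fin m →₀ ℕ, I ∈ fm.support ∧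
        bpush φ (MvPolynomial.monomial I 1) = MvPolynomial.monomial J 1) ∧
    (∃ φ' : (Fin n →₀ ℕ) → (Fin m →₀ ℕ),
      Set.InjOn φ' (↑fn.support) ∧
      Set.MapsTo φ' (↑fn.support) (↑fm.support) ∧
      (∀ J ∈ fn.support,
        bpush φ (MvPolynomial.monomial (φ' J) 1) = MvPolynomial.monomial J 1) ∧
      (∀ J ∈ fn.support, ∀ j ∈ J.support,
        ∃! i : Fin m, i ∈ (φ' J).support ∧ φ (Sum.inl i) = Sum.inl j)) := by
  have hex : ∀ J ∈ fn.support, ∃! I : Fin m →₀ ℕ, I ∈ fm.support ∧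
      bpush φ (MvPolynomial.monomial I 1) = MvPolynomial.monomial J 1 := by
    classical
    intro J hJ
    have hcard := coeff_bpush φ hm.1 J
    rw [heq, hn.1 J hJ] at hcard
    obtain ⟨I, hI⟩ := Finset.card_eq_one.mp (Nat.cast_eq_one.mp hcard.symm)
    simp only [Finset.ext_iff, Finset.mem_filter, Finset.mem_singleton] at hI
    exact ⟨I, (hI I).mpr rfl, fun I' hI' => (hI I').mp hI'⟩
  refine ⟨hex, ?_⟩
  choose! φ' hφ' using fun J hJ => (hex J hJ).exists
  refine ⟨φ', fun J hJ J' hJ' h => ?_, fun J hJ => (hφ' J hJ).1, fun J hJ => (hφ' J hJ).2,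
    fun J hJ j hj => existsUnique_preimage_of_bpush_monomial (hφ' J hJ).2 ?_⟩
  · exact monomial_left_injective one_ne_zero
      ((hφ' J hJ).2.symm.trans ((congrArg (fun I => bpush φ (monomial I 1)) h).trans
        (hφ' J' hJ').2))
  · exact le_antisymm (hn.2.1 J hJ j) (Nat.one_le_iff_ne_zero.mpr (Finsupp.mem_support_iff.mp hj))
end

section
/- Let (φ, d) : (m, R) → (n, S) and (φ', d') : (l, Q) → (m, R) be morphisms in 𝓕≀𝓕. Then for all 1 ≤ j ≤ n and 1 ≤ h ≤ s_j, the polynomial associated to the composite morphism satisfies f_{(φ,d)∘(φ',d'),h,j} = f_{φ,d,h,j}(f_{φ',d',1,1}, …, f_{φ',d',q_1,1}, …, f_{φ',d',1,l}, …, f_{φ',d',q_l,l}); that is, it is obtained from f_{φ,d,h,j} ∈ ℤ[a_1,…,a_{|R|}] by substituting, for the variable corresponding to the k-th coordinate of the i-th block of R, the polynomial f_{φ',d',k,i} ∈ ℤ[a_1,…,a_{|Q|}] (with the constant polynomials 0 and 1 substituted in the degenerate cases). -/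
open MvPolynomial

/-!
A morphism `(φ, d) : (m, R) → (n, S)` in `𝓕≀𝓕` is modelled as follows.
The based map `φ : 𝐦 → 𝐧` is a function `Fin m → Option (Fin n)`
(`none` means `φ(i) = 0`, the basepoint).  A based map out of the smash
product `⋀_{φ(i)=j} 𝐫_i` is the same thing as an arbitrary function on the
product of the sets of non-basepoint elements, so `d_j` is modelled as a
function `(∀ i : {i // φ i = some j}, Fin (R i)) → Option (Fin (S j))`
(`Fin (R i)` models `{1, …, r_i}`; for `φ⁻¹(j) = ∅` the domain is a
singleton, matching based maps out of `𝟏 = {0,1}`).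
The variables of `ℤ[a_1,…,a_{|R|}]` are identified with the pairs
`⟨i, k⟩ : Σ i : Fin m, Fin (R i)` (the `k`-th coordinate of the `i`-th block).
-/

/-- Composite of the underlying based maps. -/
def compMap {l m n : ℕ} (φ : Fin m → Option (Fin n))
    (φ' : Fin l → Option (Fin m)) : Fin l → Option (Fin n) :=
  fun i => (φ' i).bind φ

/-- Composite of the smash-product components: apply the `d'`-components
blockwise, then `d`; if any intermediate value is a basepoint, so is the
result. -/
def compD {l m n : ℕ} (Q : Fin l → ℕ) (R : Fin m → ℕ) (S : Fin n → ℕ)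
    (φ : Fin m → Option (Fin n))
    (d : ∀ j : Fin n,
      (∀ i : {i : Fin m // φ i = some j}, Fin (R i.1)) → Option (Fin (S j)))
    (φ' : Fin l → Option (Fin m))
    (d' : ∀ t : Fin m,
      (∀ i : {i : Fin l // φ' i = some t}, Fin (Q i.1)) → Option (Fin (R t)))
    (j : Fin n)
    (q : ∀ i : {i : Fin l // compMap φ φ' i = some j}, Fin (Q i.1)) :
    Option (Fin (S j)) :=
  let rt : ∀ t : {t : Fin m // φ t = some j}, Option (Fin (R t.1)) :=
    fun t => d' t.1 (fun i => q ⟨i.1, by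
      have h1 : φ' i.1 = some t.1 := i.2
      have h2 : φ t.1 = some j := t.2
      simp [compMap, h1, h2]⟩)
  if hc : ∀ t, (rt t).isSome then d j (fun t => (rt t).get (hc t)) else none

/-- The polynomial `f_{φ,d,h,j} ∈ ℤ[a_1,…,a_{|R|}]` associated to a morphism
`(φ, d) : (m, R) → (n, S)` of `𝓕≀𝓕` and a pair `(h, j)`:
`f_{φ,d,h,j} = Σ_{κ ∈ d_j⁻¹(h)} Π_{i ∈ φ⁻¹(j)} a_{⟨i, κ_i⟩}`
(which is the constant `0` or `1` when `φ⁻¹(j) = ∅`). -/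
noncomputable def polyOf {m n : ℕ} (R : Fin m → ℕ) (S : Fin n → ℕ)
    (φ : Fin m → Option (Fin n))
    (d : ∀ j : Fin n,
      (∀ i : {i : Fin m // φ i = some j}, Fin (R i.1)) → Option (Fin (S j)))
    (j : Fin n) (h : Fin (S j)) :
    MvPolynomial (Σ i : Fin m, Fin (R i)) ℤ :=
  ∑ κ ∈ Finset.univ.filter
      (fun κ : ∀ i : {i : Fin m // φ i = some j}, Fin (R i.1) =>
        d j κ = some h),
    ∏ i : {i : Fin m // φ i = some j}, MvPolynomial.X ⟨i.1, κ i⟩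

/-- The fibre of `compMap φ φ'` over `j` is the disjoint union of the fibres of `φ'` over the
points of the fibre of `φ` over `j`. -/
def compFiberEquiv {l m n : ℕ} (φ : Fin m → Option (Fin n)) (φ' : Fin l → Option (Fin m))
    (j : Fin n) :
    (Σ t : {t : Fin m // φ t = some j}, {i : Fin l // φ' i = some t.1}) ≃
      {i : Fin l // compMap φ φ' i = some j} where
  toFun p := ⟨p.2.1, by simp [compMap, p.2.2, p.1.2]⟩
  invFun i :=
    have hi := Option.bind_eq_some_iff.1 i.2
    have hs : (φ' i.1).isSome := Option.isSome_iff_exists.2 (hi.imp fun _ ht => ht.1)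
    ⟨⟨(φ' i.1).get hs, by obtain ⟨t, ht, ht'⟩ := hi; simpa [ht] using ht'⟩,
      ⟨i.1, (Option.some_get hs).symm⟩⟩
  left_inv := by
    rintro ⟨⟨t, ht⟩, ⟨i, hi⟩⟩
    have key : ∀ (t' : Fin m) (h₁ : φ t' = some j) (h₂ : φ' i = some t'), t' = t →
        (⟨⟨t', h₁⟩, ⟨i, h₂⟩⟩ :
          Σ t : {t : Fin m // φ t = some j}, {i : Fin l // φ' i = some t.1}) =
          ⟨⟨t, ht⟩, ⟨i, hi⟩⟩ := by
      rintro t' h₁ h₂ rfl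
      rfl
    exact key _ _ _ (by simp [hi])
  right_inv _ := rfl

/-- A choice of coordinates over the fibre of the composite, regrouped blockwise. -/
def compFiberPiEquiv {l m n : ℕ} (Q : Fin l → ℕ) (φ : Fin m → Option (Fin n))
    (φ' : Fin l → Option (Fin m)) (j : Fin n) :
    (∀ i : {i : Fin l // compMap φ φ' i = some j}, Fin (Q i.1)) ≃
      (∀ (t : {t : Fin m // φ t = some j}) (i : {i : Fin l // φ' i = some t.1}), Fin (Q i.1)) :=
  ((compFiberEquiv φ φ' j).piCongrLeft fun i => Fin (Q i.1)).symm.trans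
    (Equiv.piCurry fun (t : {t : Fin m // φ t = some j})
      (i : {i : Fin l // φ' i = some t.1}) => Fin (Q i.1))

theorem compD_eq_some_iff {l m n : ℕ} (Q : Fin l → ℕ) (R : Fin m → ℕ) (S : Fin n → ℕ)
    (φ : Fin m → Option (Fin n))
    (d : ∀ j : Fin n,
      (∀ i : {i : Fin m // φ i = some j}, Fin (R i.1)) → Option (Fin (S j)))
    (φ' : Fin l → Option (Fin m))
    (d' : ∀ t : Fin m,
      (∀ i : {i : Fin l // φ' i = some t}, Fin (Q i.1)) → Option (Fin (R t)))
    (j : Fin n) (h : Fin (S j))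
    (q : ∀ i : {i : Fin l // compMap φ φ' i = some j}, Fin (Q i.1)) :
    compD Q R S φ d φ' d' j q = some h ↔
      ∃ κ, d j κ = some h ∧ ∀ t, d' t.1 (compFiberPiEquiv Q φ φ' j q t) = some (κ t) := by
  have hq : compD Q R S φ d φ' d' j q =
      if hc : ∀ t : {t : Fin m // φ t = some j},
          (d' t.1 (compFiberPiEquiv Q φ φ' j q t)).isSome then
        d j (fun t => (d' t.1 (compFiberPiEquiv Q φ φ' j q t)).get (hc t)) else none := rfl
  rw [hq]
  constructor
  · intro hd
    split_ifs at hd with hc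
    exact ⟨_, hd, fun t => (Option.some_get (hc t)).symm⟩
  · rintro ⟨κ, hκ, hd'⟩
    have hc : ∀ t, (d' t.1 (compFiberPiEquiv Q φ φ' j q t)).isSome := fun t => by simp [hd' t]
    rw [dif_pos hc, ← hκ]
    congr 1
    funext t
    simp [hd' t]

/-- The polynomial associated to a composite morphism of `𝓕≀𝓕` is obtained
from the polynomial of the first morphism by substituting, for the variable
`⟨i, k⟩` (the `k`-th coordinate of the `i`-th block of `R`), the polynomial
`f_{φ',d',k,i}` associated to the second morphism. -/
theorem polyOf_comp {l m n : ℕ} (Q : Fin l → ℕ) (R : Fin m → ℕ)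
    (S : Fin n → ℕ)
    (φ : Fin m → Option (Fin n))
    (d : ∀ j : Fin n,
      (∀ i : {i : Fin m // φ i = some j}, Fin (R i.1)) → Option (Fin (S j)))
    (φ' : Fin l → Option (Fin m))
    (d' : ∀ t : Fin m,
      (∀ i : {i : Fin l // φ' i = some t}, Fin (Q i.1)) → Option (Fin (R t)))
    (j : Fin n) (h : Fin (S j)) :
    polyOf Q S (compMap φ φ') (compD Q R S φ d φ' d') j h =
      MvPolynomial.bind₁
        (fun v : Σ i : Fin m, Fin (R i) => polyOf Q R φ' d' v.1 v.2)
        (polyOf R S φ d j h) := by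
  classical
  simp only [polyOf, map_sum, map_prod, bind₁_X_right, Finset.prod_univ_sum]
  rw [Finset.sum_sigma']
  symm
  refine Finset.sum_bij (fun p _ => (compFiberPiEquiv Q φ φ' j).symm p.2) ?_ ?_ ?_ ?_
  · rintro ⟨κ, ν⟩ hp
    simp only [Finset.mem_sigma, Finset.mem_filter_univ, Fintype.mem_piFinset] at hp
    rw [Finset.mem_filter_univ, compD_eq_some_iff]
    exact ⟨κ, hp.1, by simpa using hp.2⟩
  · rintro ⟨κ, ν⟩ hp ⟨κ', ν'⟩ hp' heq
    simp only [Finset.mem_sigma, Finset.mem_filter_univ, Fintype.mem_piFinset] at hp hp'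
    obtain rfl : ν = ν' := (compFiberPiEquiv Q φ φ' j).symm.injective heq
    obtain rfl : κ = κ' := funext fun t => Option.some_injective _ ((hp.2 t).symm.trans (hp'.2 t))
    rfl
  · intro q hq
    rw [Finset.mem_filter_univ, compD_eq_some_iff] at hq
    obtain ⟨κ, hκ, hd'⟩ := hq
    exact ⟨⟨κ, compFiberPiEquiv Q φ φ' j q⟩, by simpa using ⟨hκ, fun t ht => hd' ⟨t, ht⟩⟩, by simp⟩
  · rintro ⟨κ, ν⟩ -
    obtain ⟨q, rfl⟩ := (compFiberPiEquiv Q φ φ' j).surjective ν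
    rw [Equiv.symm_apply_apply, ← (compFiberEquiv φ φ' j).prod_comp, Fintype.prod_sigma]
    rfl
end
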